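/- (Soundness of ranking functions, with quantitative bound.) Let P be a PARS over A, let ε > 0, and let f : A → ℝ≥0 be a ranking function for P with parameter ε. Then adh_P(a) ≤ f(a)/ε for every a ∈ A; in particular P is strongly almost surely terminating (SAST). -/

import Mathlib

open scoped NNReal ENNReal

/-- A finite (probability) distribution on `A`: a finitely supported weight
function with total weight `1`. -/
structure FinDist (A : Type*) where
  w : A →₀ ℝ≥0
  sum_one : w.sum (fun _ p => p) = 1

/-- Multidistributions on `A`: finite multisets of weighted elements `p:a`. -/
abbrev MD (A : Type*) := Multiset (ℝ≥0 × A)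

namespace MD

/-- The total weight `|μ|` of a multidistribution. -/
def wt {A : Type*} (μ : MD A) : ℝ≥0 := (μ.map Prod.fst).sum

/-- Scalar multiplication `p·μ`. -/
def smul {A : Type*} (p : ℝ≥0) (μ : MD A) : MD A :=
  μ.map fun qa => (p * qa.1, qa.2)

/-- The expected value `E(f(μ)) = Σ_{p:a ∈ μ} p·f(a)`. -/
def exp {A : Type*} (f : A → ℝ≥0) (μ : MD A) : ℝ≥0 :=
  (μ.map fun pa => pa.1 * f pa.2).sum

end MD

namespace FinDist

/-- The multidistribution associated with a finite distribution. -/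
def toMD {A : Type*} (d : FinDist A) : MD A :=
  d.w.support.val.map fun a => (d.w a, a)

/-- The expected value `E(f(d)) = Σ_a d(a)·f(a)`. -/
def exp {A : Type*} (f : A → ℝ≥0) (d : FinDist A) : ℝ≥0 :=
  d.w.sum fun a p => p * f a

/-- Pushforward of a finite distribution along a map; this is
`overline(h(d))`, the collapse of the elementwise image of `d`. -/
noncomputable def map {A B : Type*} (h : A → B) (d : FinDist A) : FinDist B :=
  ⟨Finsupp.mapDomain h d.w, by
    rw [Finsupp.sum_mapDomain_index (fun _ => rfl) (fun _ _ _ => rfl)]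
    exact d.sum_one⟩

/-- The Dirac distribution. -/
noncomputable def dirac {A : Type*} (a : A) : FinDist A :=
  ⟨Finsupp.single a 1, by simp⟩

end FinDist

/-- A PARS over `A`: a set of probabilistic reductions `a → d`. -/
abbrev PARS (A : Type*) := A → FinDist A → Prop

/-- `a` is terminal (a normal form) if it has no reduction. -/
def PARS.Terminal {A : Type*} (P : PARS A) (a : A) : Prop := ∀ d, ¬ P a d

/-- The probabilistic reduction relation `⇒_P` on multidistributions. -/
inductive PARS.Step {A : Type*} (P : PARS A) : MD A → MD A → Prop
  | term (a : A) : P.Terminal a → PARS.Step P {(1, a)} 0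
  | rule (a : A) (d : FinDist A) : P a d → PARS.Step P {(1, a)} d.toMD
  | conv (n : ℕ) (p : Fin n → ℝ≥0) (μ ρ : Fin n → MD A) :
      (∑ i, p i) ≤ 1 → (∀ i, PARS.Step P (μ i) (ρ i)) →
      PARS.Step P (∑ i, MD.smul (p i) (μ i)) (∑ i, MD.smul (p i) (ρ i))

/-- An (infinite) reduction sequence of `P`. -/
def PARS.RedSeq {A : Type*} (P : PARS A) (μs : ℕ → MD A) : Prop :=
  ∀ n, P.Step (μs n) (μs (n + 1))

/-- A reduction sequence of `P` starting from `μ`. -/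
def PARS.RedSeqFrom {A : Type*} (P : PARS A) (μ : MD A) (μs : ℕ → MD A) : Prop :=
  μs 0 = μ ∧ P.RedSeq μs

/-- The expected derivation length `adl(⃗μ) = Σ_{n ≥ 1} |μ_n|`. -/
noncomputable def adl {A : Type*} (μs : ℕ → MD A) : ℝ≥0∞ :=
  ∑' n : ℕ, (MD.wt (μs (n + 1)) : ℝ≥0∞)

/-- The expected derivation height `adh_P(a)`. -/
noncomputable def adh {A : Type*} (P : PARS A) (a : A) : ℝ≥0∞ :=
  ⨆ (μs : ℕ → MD A) (_ : P.RedSeqFrom {(1, a)} μs), adl μs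

/-- Strong almost sure termination. -/
def PARS.SAST {A : Type*} (P : PARS A) : Prop := ∀ a, adh P a < ⊤

/-- Almost sure termination. -/
def PARS.AST {A : Type*} (P : PARS A) : Prop :=
  ∀ μs : ℕ → MD A, P.RedSeq μs →
    Filter.Tendsto (fun n => MD.wt (μs n)) Filter.atTop (nhds 0)

/-- `f` is a (probabilistic) ranking function for `P` with parameter `ε`. -/
def PARS.Ranking {A : Type*} (P : PARS A) (ε : ℝ≥0) (f : A → ℝ≥0) : Prop :=
  ∀ a d, P a d → f a ≥ ε + FinDist.exp f d

namespace MD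

/-- The total weight as an additive monoid homomorphism. -/
def wtHom (A : Type*) : MD A →+ ℝ≥0 where
  toFun := wt
  map_zero' := by simp [wt]
  map_add' μ ρ := by simp [wt]

/-- The expected value of `f` as an additive monoid homomorphism. -/
def expHom {A : Type*} (f : A → ℝ≥0) : MD A →+ ℝ≥0 where
  toFun := exp f
  map_zero' := by simp [exp]
  map_add' μ ρ := by simp [exp]

theorem wt_sum {A ι : Type*} (s : Finset ι) (μ : ι → MD A) :
    wt (∑ i ∈ s, μ i) = ∑ i ∈ s, wt (μ i) :=
  map_sum (wtHom A) μ s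

theorem exp_sum {A ι : Type*} (f : A → ℝ≥0) (s : Finset ι) (μ : ι → MD A) :
    exp f (∑ i ∈ s, μ i) = ∑ i ∈ s, exp f (μ i) :=
  map_sum (expHom f) μ s

theorem wt_smul {A : Type*} (p : ℝ≥0) (μ : MD A) : wt (smul p μ) = p * wt μ := by
  simp [wt, smul, Multiset.map_map, Multiset.sum_map_mul_left]

theorem exp_smul {A : Type*} (f : A → ℝ≥0) (p : ℝ≥0) (μ : MD A) :
    exp f (smul p μ) = p * exp f μ := by
  simp [exp, smul, Multiset.map_map, mul_assoc, Multiset.sum_map_mul_left]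

end MD

namespace FinDist

theorem wt_toMD {A : Type*} (d : FinDist A) : MD.wt d.toMD = 1 := by
  rw [← d.sum_one]
  simp [MD.wt, toMD, Multiset.map_map, Finsupp.sum]

theorem exp_toMD {A : Type*} (f : A → ℝ≥0) (d : FinDist A) :
    MD.exp f d.toMD = FinDist.exp f d := by
  simp [MD.exp, toMD, FinDist.exp, Multiset.map_map, Finsupp.sum]

end FinDist

namespace PARS

/-- One reduction step decreases the expected rank by at least `ε` times the remaining weight. -/
theorem Ranking.step {A : Type*} {P : PARS A} {ε : ℝ≥0} {f : A → ℝ≥0} (hf : P.Ranking ε f)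
    {μ ρ : MD A} (h : P.Step μ ρ) : ε * MD.wt ρ + MD.exp f ρ ≤ MD.exp f μ := by
  induction h with
  | term a _ => simp [MD.wt, MD.exp]
  | rule a d had =>
    rw [FinDist.wt_toMD, FinDist.exp_toMD]
    simpa [MD.exp] using hf a d had
  | conv n p μ ρ _ _ ih =>
    simp only [MD.wt_sum, MD.exp_sum, MD.wt_smul, MD.exp_smul, Finset.mul_sum,
      ← Finset.sum_add_distrib]
    refine Finset.sum_le_sum fun i _ => ?_
    calc ε * (p i * MD.wt (ρ i)) + p i * MD.exp f (ρ i)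
        = p i * (ε * MD.wt (ρ i) + MD.exp f (ρ i)) := by ring
      _ ≤ p i * MD.exp f (μ i) := by gcongr; exact ih i

theorem Ranking.sum_wt_le {A : Type*} {P : PARS A} {ε : ℝ≥0} {f : A → ℝ≥0}
    (hf : P.Ranking ε f) {μs : ℕ → MD A} (h : P.RedSeq μs) (n : ℕ) :
    ε * ∑ i ∈ Finset.range n, MD.wt (μs (i + 1)) + MD.exp f (μs n) ≤ MD.exp f (μs 0) := by
  induction n with
  | zero => simp
  | succ n ih =>
    rw [Finset.sum_range_succ, mul_add, add_assoc]
    exact (add_le_add_right (hf.step (h n)) _).trans ih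

theorem Ranking.adl_le {A : Type*} {P : PARS A} {ε : ℝ≥0} (hε : 0 < ε) {f : A → ℝ≥0}
    (hf : P.Ranking ε f) {μs : ℕ → MD A} (h : P.RedSeq μs) :
    adl μs ≤ (MD.exp f (μs 0) : ℝ≥0∞) / ε := by
  refine ENNReal.tsum_le_of_sum_range_le fun n => ?_
  rw [ENNReal.le_div_iff_mul_le (by simp [hε.ne']) (by simp), mul_comm]
  exact_mod_cast le_self_add.trans (hf.sum_wt_le h n)

theorem Ranking.adh_le {A : Type*} {P : PARS A} {ε : ℝ≥0} (hε : 0 < ε) {f : A → ℝ≥0}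
    (hf : P.Ranking ε f) (a : A) : adh P a ≤ (f a : ℝ≥0∞) / ε := by
  refine iSup₂_le fun μs h => ?_
  simpa [h.1, MD.exp] using hf.adl_le hε h.2

end PARS

/-- soundness of ranking functions, with the quantitative bound
`adh_P(a) ≤ f(a)/ε`; in particular `P` is SAST. -/
theorem stmt_4 {A : Type*} [Countable A] (P : PARS A) (ε : ℝ≥0) (hε : 0 < ε)
    (f : A → ℝ≥0) (hf : P.Ranking ε f) :
    (∀ a : A, adh P a ≤ (f a : ℝ≥0∞) / (ε : ℝ≥0∞)) ∧ P.SAST := by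
  exact ⟨hf.adh_le hε, fun a => (hf.adh_le hε a).trans_lt
    (ENNReal.div_lt_top ENNReal.coe_ne_top (by simp [hε.ne']))⟩
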